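/- arXiv:1904.02229 — 3 statements merged into one kernel-verified Lean document; each statement's English description precedes it below -/
import Mathlib

section
/- Let G be a finite simple graph and v a vertex of G of degree ρ ≥ 1. Then the nullity of the Fowler construction F(G,v) equals the nullity of G: η(F(G,v)) = η(G). -/
open Matrix

/-- Adjacency matrix of a finite simple graph over `ℚ`. -/
noncomputable def adjMat {V : Type*} [Fintype V] [DecidableEq V] (G : SimpleGraph V) :
    Matrix V V ℚ :=
  letI := Classical.decRel G.Adj
  G.adjMatrix ℚ

/-- A core graph: some kernel eigenvector of the adjacency matrix has all entries nonzero. -/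
def IsCoreGraph {V : Type*} [Fintype V] [DecidableEq V] (G : SimpleGraph V) : Prop :=
  ∃ x : V → ℚ, (adjMat G).mulVec x = 0 ∧ ∀ w, x w ≠ 0

/-- The nullity of a graph: dimension of the kernel of its adjacency matrix. -/
noncomputable def nullity {V : Type*} [Fintype V] [DecidableEq V] (G : SimpleGraph V) : ℕ :=
  Module.finrank ℚ (LinearMap.ker (adjMat G).mulVecLin)

/-- A nut graph: a core graph of nullity one. -/
def IsNutGraph {V : Type*} [Fintype V] [DecidableEq V] (G : SimpleGraph V) : Prop :=
  IsCoreGraph G ∧ nullity G = 1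

/-- A graph is `ρ`-regular if every vertex has degree `ρ`. -/
def IsRegularGraph {V : Type*} (G : SimpleGraph V) (ρ : ℕ) : Prop :=
  ∀ w, Nat.card (G.neighborSet w) = ρ

/-- The Fowler construction `F(G,v)`. -/
def Fowler {V : Type*} (G : SimpleGraph V) (v : V) :
    SimpleGraph (V ⊕ (↥(G.neighborSet v) ⊕ ↥(G.neighborSet v))) :=
  SimpleGraph.fromRel (fun a b =>
    match a, b with
    | Sum.inl w₁, Sum.inl w₂ => G.Adj w₁ w₂ ∧ w₁ ≠ v ∧ w₂ ≠ v
    | Sum.inl w, Sum.inr (Sum.inl u) => w = (u : V)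
    | Sum.inl w, Sum.inr (Sum.inr _) => w = v
    | Sum.inr (Sum.inl u), Sum.inr (Sum.inr u') => (u : V) ≠ (u' : V)
    | _, _ => False)


theorem adjMat_mulVec_apply {V : Type*} [Fintype V] [DecidableEq V] (G : SimpleGraph V)
    [DecidableRel G.Adj] (x : V → ℚ) (w : V) :
    (adjMat G).mulVec x w = ∑ w', if G.Adj w w' then x w' else 0 := by
  simp only [adjMat, Matrix.mulVec, dotProduct, SimpleGraph.adjMatrix_apply, ite_mul, one_mul,
    zero_mul]

namespace Fowler

variable {V : Type*} {G : SimpleGraph V} {v : V}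

@[simp]
theorem adj_inl_inl {w₁ w₂ : V} :
    (Fowler G v).Adj (Sum.inl w₁) (Sum.inl w₂) ↔ G.Adj w₁ w₂ ∧ w₁ ≠ v ∧ w₂ ≠ v := by
  simp only [Fowler, SimpleGraph.fromRel_adj, G.adj_comm w₂ w₁]
  constructor
  · tauto
  · intro h
    exact ⟨fun e => h.1.ne (Sum.inl_injective e), Or.inl h⟩

@[simp]
theorem adj_inl_inr_inl {w : V} {u : G.neighborSet v} :
    (Fowler G v).Adj (Sum.inl w) (Sum.inr (Sum.inl u)) ↔ w = u := by
  simp [Fowler]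

@[simp]
theorem adj_inl_inr_inr {w : V} {u : G.neighborSet v} :
    (Fowler G v).Adj (Sum.inl w) (Sum.inr (Sum.inr u)) ↔ w = v := by
  simp [Fowler]

@[simp]
theorem adj_inr_inl_inl {w : V} {u : G.neighborSet v} :
    (Fowler G v).Adj (Sum.inr (Sum.inl u)) (Sum.inl w) ↔ w = u := by
  simp [Fowler]

@[simp]
theorem adj_inr_inr_inl {w : V} {u : G.neighborSet v} :
    (Fowler G v).Adj (Sum.inr (Sum.inr u)) (Sum.inl w) ↔ w = v := by
  simp [Fowler]

@[simp]
theorem adj_inr_inl_inr_inl {u u' : G.neighborSet v} :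
    ¬ (Fowler G v).Adj (Sum.inr (Sum.inl u)) (Sum.inr (Sum.inl u')) := by
  simp [Fowler]

@[simp]
theorem adj_inr_inr_inr_inr {u u' : G.neighborSet v} :
    ¬ (Fowler G v).Adj (Sum.inr (Sum.inr u)) (Sum.inr (Sum.inr u')) := by
  simp [Fowler]

@[simp]
theorem adj_inr_inl_inr_inr {u u' : G.neighborSet v} :
    (Fowler G v).Adj (Sum.inr (Sum.inl u)) (Sum.inr (Sum.inr u')) ↔ u' ≠ u := by
  simp [Fowler, Subtype.ext_iff, eq_comm]

@[simp]
theorem adj_inr_inr_inr_inl {u u' : G.neighborSet v} :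
    (Fowler G v).Adj (Sum.inr (Sum.inr u)) (Sum.inr (Sum.inl u')) ↔ u' ≠ u := by
  simp [Fowler, Subtype.ext_iff]

theorem sum_ite_ne {ι : Type*} [Fintype ι] [DecidableEq ι] (f : ι → ℚ) (i : ι) :
    (∑ j, if j = i then 0 else f j) = (∑ j, f j) - f i := by
  rw [eq_sub_iff_add_eq, ← Finset.sum_ite_eq' Finset.univ i f |>.trans (if_pos (Finset.mem_univ i)),
    ← Finset.sum_add_distrib]
  exact Finset.sum_congr rfl fun j _ => by split_ifs <;> simp

theorem sum_neighborSet [Fintype V] [DecidableRel G.Adj] (y : V → ℚ) :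
    ∑ u : G.neighborSet v, y u = ∑ w, if G.Adj v w then y w else 0 := by
  rw [← Finset.sum_filter]
  exact (Finset.sum_subtype _ (by simp) y).symm

section Kernel

variable [Fintype V] [DecidableEq V] [DecidableRel G.Adj]

theorem sum_ite_eq_coe (a : ℚ) (w : V) :
    (∑ u : G.neighborSet v, if w = u then a else 0) = if G.Adj v w then a else 0 := by
  rw [sum_neighborSet (fun u => if w = u then a else 0)]
  simp only [← ite_and, and_comm]
  simp [ite_and]

theorem mulVec_eq_zero_iff
    (z : V ⊕ (G.neighborSet v ⊕ G.neighborSet v) → ℚ) :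
    (adjMat (Fowler G v)).mulVec z = 0 ↔
      (∀ w, ((∑ w', if G.Adj w w' ∧ w ≠ v ∧ w' ≠ v then z (Sum.inl w') else 0) +
        ((∑ u : G.neighborSet v, if w = u then z (Sum.inr (Sum.inl u)) else 0) +
          ∑ u : G.neighborSet v, if w = v then z (Sum.inr (Sum.inr u)) else 0)) = 0) ∧
      (∀ u : G.neighborSet v, z (Sum.inl u) +
        ((∑ u', z (Sum.inr (Sum.inr u'))) - z (Sum.inr (Sum.inr u))) = 0) ∧
      (∀ u : G.neighborSet v, z (Sum.inl v) +
        ((∑ u', z (Sum.inr (Sum.inl u'))) - z (Sum.inr (Sum.inl u))) = 0) := by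
  classical
  simp only [funext_iff, adjMat_mulVec_apply, Sum.forall, Fintype.sum_sum_type, adj_inl_inl,
    adj_inl_inr_inl, adj_inl_inr_inr, adj_inr_inl_inl, adj_inr_inr_inl, adj_inr_inl_inr_inl,
    adj_inr_inr_inr_inr, adj_inr_inl_inr_inr, adj_inr_inr_inr_inl, Pi.zero_apply, ite_not, ne_eq,
    sum_ite_ne, Finset.sum_ite_eq', Finset.mem_univ, if_true, if_false, Finset.sum_const_zero,
    zero_add, add_zero]

variable (G v) in
/-- The extension to `F(G,v)` of a vector on `G` which identifies the kernels. -/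
def lift : (V → ℚ) →ₗ[ℚ] (V ⊕ (G.neighborSet v ⊕ G.neighborSet v) → ℚ) where
  toFun y := Sum.elim (fun w => if w = v then (1 - (Fintype.card (G.neighborSet v) : ℚ)) * y v
    else y w) (Sum.elim (fun _ => y v) (fun u => y u))
  map_add' y z := by
    ext (w | u | u)
    · by_cases h : w = v <;> simp [h, mul_add]
    · simp
    · simp
  map_smul' c y := by
    ext (w | u | u)
    · by_cases h : w = v <;> simp [h, mul_left_comm]
    · simp
    · simp

theorem lift_injective [Nonempty (G.neighborSet v)] : Function.Injective (lift G v) := by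
  intro y z h
  ext w
  by_cases hw : w = v
  · obtain ⟨u⟩ := ‹Nonempty (G.neighborSet v)›
    simpa [lift, hw] using congrFun h (Sum.inr (Sum.inl u))
  · simpa [lift, hw] using congrFun h (Sum.inl w)

theorem sum_adj_ne (y : V → ℚ) (w : V) (hw : w ≠ v) :
    (∑ w', if G.Adj w w' ∧ w ≠ v ∧ w' ≠ v then y w' else 0) + (if G.Adj v w then y v else 0) =
      ∑ w', if G.Adj w w' then y w' else 0 := by
  have h : (if G.Adj v w then y v else 0) =
      ∑ w', if w' = v then (if G.Adj w w' then y w' else 0) else 0 := by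
    simp [G.adj_comm]
  rw [h, ← Finset.sum_add_distrib]
  refine Finset.sum_congr rfl fun w' _ => ?_
  by_cases h : w' = v <;> simp [h, hw]

theorem lift_mulVec_eq_zero_iff (y : V → ℚ) :
    (adjMat (Fowler G v)).mulVec (lift G v y) = 0 ↔ (adjMat G).mulVec y = 0 := by
  have hne (u : G.neighborSet v) : (u : V) ≠ v := u.2.ne'
  have hrow (w : V) (hw : w ≠ v) :
      (∑ w', if G.Adj w w' ∧ w ≠ v ∧ w' ≠ v then lift G v y (Sum.inl w') else 0) =
        ∑ w', if G.Adj w w' ∧ w ≠ v ∧ w' ≠ v then y w' else 0 :=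
    Finset.sum_congr rfl fun w' _ => by
      by_cases h : w' = v <;> simp [lift, h]
  rw [mulVec_eq_zero_iff, funext_iff]
  simp only [adjMat_mulVec_apply, Pi.zero_apply]
  constructor
  · rintro ⟨h, -, -⟩ w
    have hw := h w
    by_cases e : w = v
    · subst e
      simpa [lift, (hne _).symm, sum_neighborSet] using hw
    · rw [hrow w e] at hw
      simpa [← sum_adj_ne y w e, lift, e, sum_ite_eq_coe] using hw
  · intro h
    refine ⟨fun w => ?_, fun u => ?_, fun u => ?_⟩
    · by_cases e : w = v
      · subst e
        simpa [lift, (hne _).symm, sum_neighborSet] using h w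
      · rw [hrow w e]
        simpa [← sum_adj_ne y w e, lift, e, sum_ite_eq_coe] using h w
    · simp [lift, hne, sum_neighborSet, h v]
    · simp [lift]
      ring

theorem exists_lift_eq [Nonempty (G.neighborSet v)]
    {z : V ⊕ (G.neighborSet v ⊕ G.neighborSet v) → ℚ}
    (hz : (adjMat (Fowler G v)).mulVec z = 0) : ∃ y, lift G v y = z := by
  obtain ⟨h, hp, hq⟩ := mulVec_eq_zero_iff z |>.1 hz
  have hne (u : G.neighborSet v) : (u : V) ≠ v := u.2.ne'
  have hB : ∑ u, z (Sum.inr (Sum.inr u)) = 0 := by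
    simpa [(hne _).symm] using h v
  obtain ⟨u₀⟩ := ‹Nonempty (G.neighborSet v)›
  have hconst (u) : z (Sum.inr (Sum.inl u)) = z (Sum.inr (Sum.inl u₀)) := by
    linarith [hq u, hq u₀]
  have hv := hq u₀
  simp only [hconst, Finset.sum_const, Finset.card_univ, nsmul_eq_mul] at hv
  refine ⟨fun w => if w = v then z (Sum.inr (Sum.inl u₀)) else z (Sum.inl w), ?_⟩
  ext (w | u | u)
  · by_cases e : w = v
    · simp only [lift, LinearMap.coe_mk, AddHom.coe_mk, Sum.elim_inl, e, if_true]
      linarith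
    · simp [lift, e]
  · simp [lift, hconst u]
  · have := hp u
    simp only [lift, LinearMap.coe_mk, AddHom.coe_mk, Sum.elim_inr, hne, if_false]
    linarith

end Kernel

end Fowler

/-- The nullity of the Fowler construction `F(G,v)` equals the nullity of `G`. -/
theorem nullity_fowler {V : Type*} [Fintype V] [DecidableEq V]
    (G : SimpleGraph V) [DecidableRel G.Adj] (v : V) (rho : ℕ) (hrho : 1 ≤ rho)
    (hdeg : Nat.card (G.neighborSet v) = rho) :
    nullity (Fowler G v) = nullity G := by
  have : Nonempty (G.neighborSet v) := (Nat.card_pos_iff.1 (by omega)).1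
  have hmap : (LinearMap.ker (adjMat G).mulVecLin).map (Fowler.lift G v) =
      LinearMap.ker (adjMat (Fowler G v)).mulVecLin := by
    ext z
    simp only [Submodule.mem_map, LinearMap.mem_ker, Matrix.mulVecLin_apply]
    constructor
    · rintro ⟨y, hy, rfl⟩
      exact (Fowler.lift_mulVec_eq_zero_iff y).2 hy
    · intro hz
      obtain ⟨y, rfl⟩ := Fowler.exists_lift_eq hz
      exact ⟨y, (Fowler.lift_mulVec_eq_zero_iff y).1 hz, rfl⟩
  rw [nullity, nullity, ← hmap]
  exact (Submodule.equivMapOfInjective _ Fowler.lift_injective _).finrank_eq.symm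
end

section
/- Let G be a finite simple graph and v a vertex of G of degree ρ ≥ 1. Then G is a nut graph if and only if the Fowler construction F(G,v) is a nut graph. -/
open Matrix

theorem adjMat_mulVec_eq_zero_iff {V : Type*} [Fintype V] [DecidableEq V]
    (G : SimpleGraph V) [DecidableRel G.Adj] (x : V → ℚ) :
    (adjMat G).mulVec x = 0 ↔ ∀ w, ∑ z, (if G.Adj w z then x z else 0) = 0 := by
  have h : adjMat G = G.adjMatrix ℚ := by
    unfold adjMat
    ext i j
    simp [SimpleGraph.adjMatrix_apply]
  rw [h, funext_iff]
  simp [Matrix.mulVec, dotProduct, SimpleGraph.adjMatrix_apply]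

section FowlerAdj

variable {V : Type*} (G : SimpleGraph V) (v : V)

theorem fowler_adj_inl_inl (a b : V) :
    (Fowler G v).Adj (Sum.inl a) (Sum.inl b) ↔ G.Adj a b ∧ a ≠ v ∧ b ≠ v := by
  have := G.adj_comm a b
  have h : G.Adj a b → a ≠ b := fun h => h.ne
  simp only [Fowler, SimpleGraph.fromRel_adj, ne_eq, Sum.inl.injEq]
  tauto

theorem fowler_adj_inl_p (a : V) (u : G.neighborSet v) :
    (Fowler G v).Adj (Sum.inl a) (Sum.inr (Sum.inl u)) ↔ a = u := by
  simp [Fowler]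

theorem fowler_adj_inl_q (a : V) (u : G.neighborSet v) :
    (Fowler G v).Adj (Sum.inl a) (Sum.inr (Sum.inr u)) ↔ a = v := by
  simp [Fowler]

theorem fowler_adj_p_p (a b : G.neighborSet v) :
    ¬ (Fowler G v).Adj (Sum.inr (Sum.inl a)) (Sum.inr (Sum.inl b)) := by
  simp [Fowler]

theorem fowler_adj_q_q (a b : G.neighborSet v) :
    ¬ (Fowler G v).Adj (Sum.inr (Sum.inr a)) (Sum.inr (Sum.inr b)) := by
  simp [Fowler]

theorem fowler_adj_p_q (a b : G.neighborSet v) :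
    (Fowler G v).Adj (Sum.inr (Sum.inl a)) (Sum.inr (Sum.inr b)) ↔ a ≠ b := by
  simp [Fowler, Subtype.ext_iff]

end FowlerAdj

section FowlerKernel

variable {V : Type*} [Fintype V] [DecidableEq V] (G : SimpleGraph V) [DecidableRel G.Adj] (v : V)

/-- The adjacency kernel equations of `G`, with the contributions of `v` separated out. -/
theorem adjMat_mulVec_eq_zero_iff_of_vertex (x : V → ℚ) :
    (adjMat G).mulVec x = 0 ↔ ∑ u : G.neighborSet v, x u = 0 ∧
      ∀ w, w ≠ v → ∑ z, (if G.Adj w z ∧ z ≠ v then x z else 0) +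
        (if G.Adj v w then x v else 0) = 0 := by
  rw [adjMat_mulVec_eq_zero_iff]
  have hv : ∑ z, (if G.Adj v z then x z else 0) = ∑ u : G.neighborSet v, x u := by
    rw [← Finset.sum_filter]
    exact (Finset.sum_subtype _ (by simp) _)
  have hw (w : V) : ∑ z, (if G.Adj w z then x z else 0) =
      ∑ z, (if G.Adj w z ∧ z ≠ v then x z else 0) + (if G.Adj v w then x v else 0) := by
    have : (if G.Adj v w then x v else 0) =
        ∑ z, if z = v then (if G.Adj v w then x v else 0) else 0 := by simp
    rw [this, ← Finset.sum_add_distrib]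
    refine Finset.sum_congr rfl fun z _ => ?_
    by_cases hz : z = v
    · subst hz
      simp [G.adj_comm]
    · simp [hz]
  constructor
  · intro h
    exact ⟨hv ▸ h v, fun w _ => hw w ▸ h w⟩
  · rintro ⟨h₁, h₂⟩ w
    by_cases h : w = v
    · rw [h, hv, h₁]
    · rw [hw, h₂ w h]

theorem adjMat_fowler_mulVec_eq_zero_iff
    (y : V ⊕ (↥(G.neighborSet v) ⊕ ↥(G.neighborSet v)) → ℚ) :
    (adjMat (Fowler G v)).mulVec y = 0 ↔
      ∑ u, y (Sum.inr (Sum.inr u)) = 0 ∧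
      (∀ w, w ≠ v → ∑ z, (if G.Adj w z ∧ z ≠ v then y (Sum.inl z) else 0) +
        ∑ u : G.neighborSet v, (if w = u then y (Sum.inr (Sum.inl u)) else 0) = 0) ∧
      (∀ u : G.neighborSet v, y (Sum.inl u) + ∑ t, y (Sum.inr (Sum.inr t))
        = y (Sum.inr (Sum.inr u))) ∧
      (∀ u : G.neighborSet v, y (Sum.inl v) + ∑ t, y (Sum.inr (Sum.inl t))
        = y (Sum.inr (Sum.inl u))) := by
  classical
  have off (f : G.neighborSet v → ℚ) (u : G.neighborSet v) :
      ∑ t, (if u = t then 0 else f t) = ∑ t, f t - f u := by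
    have : f u = ∑ t, if u = t then f t else 0 := by simp
    rw [this, ← Finset.sum_sub_distrib]
    exact Finset.sum_congr rfl fun t _ => by split_ifs <;> simp
  have ne_v (u : G.neighborSet v) : v ≠ u := G.ne_of_adj u.2
  have hq (a : G.neighborSet v) (b : V) :
      (Fowler G v).Adj (Sum.inr (Sum.inr a)) (Sum.inl b) ↔ b = v := by
    rw [SimpleGraph.adj_comm, fowler_adj_inl_q]
  have hp (a : G.neighborSet v) (b : V) :
      (Fowler G v).Adj (Sum.inr (Sum.inl a)) (Sum.inl b) ↔ b = a := by
    rw [SimpleGraph.adj_comm, fowler_adj_inl_p]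
  have hqp (a b : G.neighborSet v) :
      (Fowler G v).Adj (Sum.inr (Sum.inr a)) (Sum.inr (Sum.inl b)) ↔ a ≠ b := by
    rw [SimpleGraph.adj_comm, fowler_adj_p_q, ne_comm]
  rw [adjMat_mulVec_eq_zero_iff]
  simp only [Sum.forall, Fintype.sum_sum_type, fowler_adj_inl_inl, fowler_adj_inl_p,
    fowler_adj_inl_q, fowler_adj_p_p, fowler_adj_q_q, fowler_adj_p_q, hp, hq, hqp,
    Finset.sum_ite_eq', Finset.mem_univ, if_true, if_false, Finset.sum_const_zero, zero_add,
    add_zero, ite_not, ne_eq, off]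
  constructor
  · rintro ⟨h₁, h₂, h₃⟩
    refine ⟨by simpa [ne_v] using h₁ v, fun w hw => by simpa [hw] using h₁ w,
      fun u => by linarith [h₂ u], fun u => by linarith [h₃ u]⟩
  · rintro ⟨h₁, h₂, h₃, h₄⟩
    refine ⟨fun w => ?_, fun u => by linarith [h₃ u], fun u => by linarith [h₄ u]⟩
    by_cases hw : w = v
    · subst hw
      simpa [ne_v] using h₁
    · simpa [hw] using h₂ w hw

/-- The extension of a vector on `G` to a vector on `Fowler G v` that identifies the kernels. -/
def fowlerExtend : (V → ℚ) →ₗ[ℚ] (V ⊕ (↥(G.neighborSet v) ⊕ ↥(G.neighborSet v)) → ℚ) where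
  toFun x := Sum.elim (fun w => if w = v then (1 - (G.degree v : ℚ)) * x v else x w)
    (Sum.elim (fun _ => x v) (fun u => x u))
  map_add' x y := by
    ext (w | u | u)
    · by_cases hw : w = v <;> simp [hw, mul_add]
    · simp
    · simp
  map_smul' c x := by
    ext (w | u | u)
    · by_cases hw : w = v <;> simp [hw, mul_left_comm]
    · simp
    · simp

@[simp] theorem fowlerExtend_inl (x : V → ℚ) (w : V) : fowlerExtend G v x (Sum.inl w) =
    if w = v then (1 - (G.degree v : ℚ)) * x v else x w := rfl

@[simp] theorem fowlerExtend_p (x : V → ℚ) (u : G.neighborSet v) :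
    fowlerExtend G v x (Sum.inr (Sum.inl u)) = x v := rfl

@[simp] theorem fowlerExtend_q (x : V → ℚ) (u : G.neighborSet v) :
    fowlerExtend G v x (Sum.inr (Sum.inr u)) = x u := rfl

theorem fowlerExtend_injective [Nonempty (G.neighborSet v)] :
    Function.Injective (fowlerExtend G v) := by
  intro x y h
  ext w
  by_cases hw : w = v
  · have u : G.neighborSet v := Classical.arbitrary _
    simpa [hw] using congrFun h (Sum.inr (Sum.inl u))
  · simpa [hw] using congrFun h (Sum.inl w)

theorem sum_ite_eq_neighbor (w : V) (c : ℚ) :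
    ∑ u : G.neighborSet v, (if w = u then c else 0) = if G.Adj v w then c else 0 := by
  by_cases h : G.Adj v w
  · rw [if_pos h, Finset.sum_eq_single (⟨w, h⟩ : G.neighborSet v)]
    · simp
    · intro b _ hb
      exact if_neg fun e => hb (Subtype.ext e.symm)
    · simp
  · rw [if_neg h]
    refine Finset.sum_eq_zero fun u _ => if_neg ?_
    rintro rfl
    exact h u.2

theorem sum_adj_ne_congr {x y : V → ℚ} (h : ∀ z, z ≠ v → x z = y z) (w : V) :
    ∑ z, (if G.Adj w z ∧ z ≠ v then x z else 0) =
      ∑ z, (if G.Adj w z ∧ z ≠ v then y z else 0) :=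
  Finset.sum_congr rfl fun z _ => by
    split_ifs with hz
    · exact h z hz.2
    · rfl

theorem adjMat_fowler_mulVec_fowlerExtend {x : V → ℚ} (hx : (adjMat G).mulVec x = 0) :
    (adjMat (Fowler G v)).mulVec (fowlerExtend G v x) = 0 := by
  obtain ⟨h₁, h₂⟩ := (adjMat_mulVec_eq_zero_iff_of_vertex G v x).1 hx
  rw [adjMat_fowler_mulVec_eq_zero_iff]
  simp only [fowlerExtend_q, fowlerExtend_p, sum_ite_eq_neighbor, h₁, true_and]
  refine ⟨fun w hw => ?_, fun u => ?_, fun u => ?_⟩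
  · refine Eq.trans ?_ (h₂ w hw)
    rw [sum_adj_ne_congr G v (y := x)]
    intro z hz
    simp [hz]
  · simp [(G.ne_of_adj u.2).symm]
  · simp only [fowlerExtend_inl, if_true, Finset.sum_const, Finset.card_univ,
      SimpleGraph.card_neighborSet_eq_degree, nsmul_eq_mul]
    ring

theorem exists_fowlerExtend_eq [Nonempty (G.neighborSet v)]
    {y : V ⊕ (↥(G.neighborSet v) ⊕ ↥(G.neighborSet v)) → ℚ}
    (hy : (adjMat (Fowler G v)).mulVec y = 0) :
    ∃ x, (adjMat G).mulVec x = 0 ∧ fowlerExtend G v x = y := by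
  obtain ⟨h₁, h₂, h₃, h₄⟩ := (adjMat_fowler_mulVec_eq_zero_iff G v y).1 hy
  obtain ⟨u₀⟩ := ‹Nonempty (G.neighborSet v)›
  set c := y (Sum.inr (Sum.inl u₀))
  have hp (u) : y (Sum.inr (Sum.inl u)) = c := by rw [← h₄ u, h₄ u₀]
  have hq (u : G.neighborSet v) : y (Sum.inl u) = y (Sum.inr (Sum.inr u)) := by
    rw [← h₃ u, h₁, add_zero]
  have hv : y (Sum.inl v) = (1 - (G.degree v : ℚ)) * c := by
    have := h₄ u₀
    simp only [hp, Finset.sum_const, Finset.card_univ, SimpleGraph.card_neighborSet_eq_degree,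
      nsmul_eq_mul] at this
    linarith
  have ne_v (u : G.neighborSet v) : (u : V) ≠ v := (G.ne_of_adj u.2).symm
  refine ⟨fun w => if w = v then c else y (Sum.inl w), ?_, ?_⟩
  · rw [adjMat_mulVec_eq_zero_iff_of_vertex G v]
    refine ⟨by simpa [ne_v, hq] using h₁, fun w hw => ?_⟩
    refine Eq.trans ?_ (h₂ w hw)
    rw [sum_adj_ne_congr G v (y := fun z => y (Sum.inl z)) (by simp +contextual)]
    simp [hp, sum_ite_eq_neighbor]
  · ext (w | u | u)
    · by_cases hw : w = v <;> simp [hw, hv]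
    · simp [hp]
    · simp [ne_v, hq]

theorem nullity_fowler_s5 [Nonempty (G.neighborSet v)] : nullity (Fowler G v) = nullity G := by
  have h : LinearMap.ker (adjMat (Fowler G v)).mulVecLin =
      (LinearMap.ker (adjMat G).mulVecLin).map (fowlerExtend G v) := by
    ext y
    simp only [LinearMap.mem_ker, Matrix.mulVecLin_apply, Submodule.mem_map]
    refine ⟨exists_fowlerExtend_eq G v, ?_⟩
    rintro ⟨x, hx, rfl⟩
    exact adjMat_fowler_mulVec_fowlerExtend G v hx
  rw [nullity, nullity, h]
  exact (Submodule.equivMapOfInjective _ (fowlerExtend_injective G v) _).finrank_eq.symm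

theorem isCoreGraph_fowler_iff [Nonempty (G.neighborSet v)] :
    IsCoreGraph (Fowler G v) ↔ IsCoreGraph G := by
  constructor
  · rintro ⟨y, hy, hy₀⟩
    obtain ⟨x, hx, rfl⟩ := exists_fowlerExtend_eq G v hy
    refine ⟨x, hx, fun w => ?_⟩
    by_cases hw : w = v
    · have u : G.neighborSet v := Classical.arbitrary _
      simpa [hw] using hy₀ (Sum.inr (Sum.inl u))
    · simpa [hw] using hy₀ (Sum.inl w)
  · rintro ⟨x, hx, hx₀⟩
    have hdeg : G.degree v ≠ 1 := by
      intro hd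
      rw [← SimpleGraph.card_neighborSet_eq_degree, Fintype.card_eq_one_iff] at hd
      obtain ⟨u, hu⟩ := hd
      have hsum := ((adjMat_mulVec_eq_zero_iff_of_vertex G v x).1 hx).1
      rw [Fintype.sum_eq_single u fun t ht => absurd (hu t) ht] at hsum
      exact hx₀ u hsum
    refine ⟨_, adjMat_fowler_mulVec_fowlerExtend G v hx, ?_⟩
    rintro (w | u | u)
    · by_cases hw : w = v
      · have : (1 - (G.degree v : ℚ)) ≠ 0 := by
          rw [sub_ne_zero]
          exact_mod_cast hdeg.symm
        simpa [hw, this] using hx₀ v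
      · simpa [hw] using hx₀ w
    · exact hx₀ v
    · exact hx₀ u

end FowlerKernel

/-- `G` is a nut graph if and only if its Fowler construction `F(G,v)` is a nut graph. -/
theorem isNutGraph_iff_fowler {V : Type*} [Fintype V] [DecidableEq V]
    (G : SimpleGraph V) [DecidableRel G.Adj] (v : V) (rho : ℕ) (hrho : 1 ≤ rho)
    (hdeg : Nat.card (G.neighborSet v) = rho) :
    IsNutGraph G ↔ IsNutGraph (Fowler G v) := by
  have : Nonempty (G.neighborSet v) := (Nat.card_pos_iff.1 (by omega)).1
  rw [IsNutGraph, IsNutGraph, nullity_fowler_s5, isCoreGraph_fowler_iff]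
end

section
/- For every integer n ≥ 3, the nullity of the antiprism graph A_n on 2n vertices equals 3 if n is divisible by 3, and equals 1 otherwise. -/
open Matrix

/-- The antiprism graph `A_n`, i.e. the circulant graph `Ci_{2n}(1,2)` on `ℤ/2nℤ`:
`i` and `j` adjacent iff `i - j ≡ ±1, ±2 (mod 2n)`. -/
def antiprism (n : ℕ) : SimpleGraph (ZMod (2 * n)) :=
  SimpleGraph.fromRel (fun i j => i - j = 1 ∨ i - j = 2)

/-- The functions on `ℤ/2nℤ` that change sign under translation by `d`. -/
def antiperiodicFunctions (n d : ℕ) : Submodule ℚ (ZMod (2 * n) → ℚ) where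
  carrier := {f | ∀ i, f (i + d) = -f i}
  add_mem' {f g} hf hg i := by
    simp only [Pi.add_apply, hf i, hg i]
    ring
  zero_mem' i := by simp
  smul_mem' c f hf i := by simp [hf i]

lemma mem_antiperiodicFunctions {n d : ℕ} {f : ZMod (2 * n) → ℚ} :
    f ∈ antiperiodicFunctions n d ↔ ∀ i, f (i + d) = -f i :=
  Iff.rfl

lemma apply_add_mul_of_mem_antiperiodicFunctions {n d : ℕ} {f : ZMod (2 * n) → ℚ}
    (hf : f ∈ antiperiodicFunctions n d) (i : ZMod (2 * n)) (k : ℕ) :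
    f (i + d * k) = (-1) ^ k * f i := by
  induction k with
  | zero => simp
  | succ k ih =>
    rw [show i + (d : ZMod (2 * n)) * ((k + 1 : ℕ) : ZMod (2 * n)) = i + d * k + d by
      push_cast; ring, hf, ih]
    ring

/-- The extension of `v : Fin d → ℚ` to a function on `ℕ` that changes sign under translation
by `d`. -/
def antiperiodicExtension (d : ℕ) [NeZero d] (v : Fin d → ℚ) (k : ℕ) : ℚ :=
  (-1) ^ (k / d) * v (Fin.ofNat d k)

lemma antiperiodicExtension_add (d : ℕ) [NeZero d] (v : Fin d → ℚ) (k : ℕ) :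
    antiperiodicExtension d v (k + d) = -antiperiodicExtension d v k := by
  have h : Fin.ofNat d (k + d) = Fin.ofNat d k := by
    ext
    simp
  rw [antiperiodicExtension, antiperiodicExtension, h,
    Nat.add_div_right _ (Nat.pos_of_neZero d), pow_succ]
  ring

lemma antiperiodicExtension_periodic {n d : ℕ} [NeZero d] (hd : d ∣ n) (v : Fin d → ℚ) :
    Function.Periodic (antiperiodicExtension d v) (2 * n) := by
  obtain ⟨m, rfl⟩ := hd
  have h : Function.Periodic (antiperiodicExtension d v) (2 * d) := fun k => by
    rw [two_mul, ← add_assoc, antiperiodicExtension_add, antiperiodicExtension_add, neg_neg]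
  have h' := h.nat_mul m
  rwa [Nat.cast_id, show m * (2 * d) = 2 * (d * m) by ring] at h'

lemma antiperiodicExtension_val {n d : ℕ} [NeZero d] (hd : d ∣ n) (v : Fin d → ℚ) (k : ℕ) :
    antiperiodicExtension d v (k : ZMod (2 * n)).val = antiperiodicExtension d v k := by
  rw [ZMod.val_natCast, (antiperiodicExtension_periodic hd v).map_mod_nat]

/-- A function that changes sign under translation by `d` is determined by its first `d` values,
which are arbitrary. -/
def antiperiodicFunctionsEquiv {n d : ℕ} [NeZero n] [NeZero d] (hd : d ∣ n) :
    antiperiodicFunctions n d ≃ₗ[ℚ] (Fin d → ℚ) where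
  toFun f r := f.1 (r.val : ZMod (2 * n))
  map_add' _ _ := rfl
  map_smul' _ _ := rfl
  invFun v := ⟨fun i => antiperiodicExtension d v i.val, fun i => by
    obtain ⟨k, rfl⟩ := ZMod.natCast_zmod_surjective i
    rw [← Nat.cast_add]
    simp only [antiperiodicExtension_val hd, antiperiodicExtension_add]⟩
  left_inv f := by
    ext i
    have h := apply_add_mul_of_mem_antiperiodicFunctions f.2 ((i.val % d : ℕ) : ZMod (2 * n))
      (i.val / d)
    rw [← Nat.cast_mul, ← Nat.cast_add, Nat.mod_add_div, ZMod.natCast_zmod_val] at h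
    simp [antiperiodicExtension, h]
  right_inv v := by
    ext r
    simp only [antiperiodicExtension_val hd]
    simp [antiperiodicExtension, Nat.div_eq_of_lt r.isLt]

lemma finrank_antiperiodicFunctions {n d : ℕ} [NeZero n] [NeZero d] (hd : d ∣ n) :
    Module.finrank ℚ (antiperiodicFunctions n d) = d := by
  simp [(antiperiodicFunctionsEquiv hd).finrank_eq]

lemma antiperiodicFunctions_three_eq_one {n : ℕ} (hn : ¬ 3 ∣ n) :
    antiperiodicFunctions n 3 = antiperiodicFunctions n 1 := by
  ext f
  refine ⟨fun hf i => ?_, fun hf i => ?_⟩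
  · obtain ⟨u, hu, m, hm⟩ : ∃ u : ℕ, Odd u ∧ ∃ m, 3 * u = 1 + 2 * n * m := by
      rcases (by omega : n % 3 = 1 ∨ n % 3 = 2) with h | h
      · exact ⟨2 * (n / 3) + 1, ⟨n / 3, rfl⟩, 1, by omega⟩
      · exact ⟨2 * (2 * (n / 3) + 1) + 1, ⟨_, rfl⟩, 2, by omega⟩
    have h := apply_add_mul_of_mem_antiperiodicFunctions hf i u
    have h1 : ((3 : ℕ) : ZMod (2 * n)) * u = ((1 : ℕ) : ZMod (2 * n)) := by
      rw [← Nat.cast_mul, hm, Nat.cast_add, Nat.cast_mul, ZMod.natCast_self]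
      simp
    rw [h1, hu.neg_one_pow] at h
    simpa using h
  · have h := apply_add_mul_of_mem_antiperiodicFunctions hf i 3
    norm_num at h ⊢
    exact h

lemma adjMat_antiprism_mulVec {n : ℕ} [NeZero n] (hn : 3 ≤ n) (f : ZMod (2 * n) → ℚ)
    (i : ZMod (2 * n)) :
    (adjMat (antiprism n)).mulVec f i = f (i + 1) + f (i - 1) + f (i + 2) + f (i - 2) := by
  classical
  have hne (k : ℕ) (h0 : 0 < k) (h4 : k ≤ 4) : (k : ZMod (2 * n)) ≠ 0 := by
    rw [Ne, ZMod.natCast_eq_zero_iff]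
    exact Nat.not_dvd_of_pos_of_lt h0 (by omega)
  have h1 : (1 : ZMod (2 * n)) ≠ 0 := mod_cast hne 1 (by simp) (by simp)
  have h2 : (2 : ZMod (2 * n)) ≠ 0 := mod_cast hne 2 (by simp) (by simp)
  have h3 : (3 : ZMod (2 * n)) ≠ 0 := mod_cast hne 3 (by simp) (by simp)
  have h4 : (4 : ZMod (2 * n)) ≠ 0 := mod_cast hne 4 (by simp) (by simp)
  rw [adjMat, SimpleGraph.adjMatrix_mulVec_apply]
  have hN : ∀ j, (antiprism n).Adj i j ↔
      j ∈ ({i + 1, i - 1, i + 2, i - 2} : Finset (ZMod (2 * n))) := by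
    intro j
    simp only [antiprism, SimpleGraph.fromRel_adj, Finset.mem_insert, Finset.mem_singleton]
    grind
  rw [show (SimpleGraph.neighborFinset _ i) = {i + 1, i - 1, i + 2, i - 2} by
      ext j
      rw [SimpleGraph.mem_neighborFinset, hN],
    Finset.sum_insert, Finset.sum_insert, Finset.sum_insert, Finset.sum_singleton]
  · ring
  · rw [Finset.mem_singleton]
    exact fun h => h4 (by linear_combination h)
  · simp only [Finset.mem_insert, Finset.mem_singleton]
    rintro (h | h)
    · exact h3 (by linear_combination -h)
    · exact h1 (by linear_combination h)
  · simp only [Finset.mem_insert, Finset.mem_singleton]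
    rintro (h | h | h)
    · exact h2 (by linear_combination h)
    · exact h1 (by linear_combination -h)
    · exact h3 (by linear_combination h)

lemma ker_adjMat_antiprism {n : ℕ} [NeZero n] (hn : 3 ≤ n) :
    LinearMap.ker (adjMat (antiprism n)).mulVecLin = antiperiodicFunctions n 3 := by
  ext f
  rw [LinearMap.mem_ker, Matrix.mulVecLin_apply, mem_antiperiodicFunctions, funext_iff]
  simp only [adjMat_antiprism_mulVec hn, Pi.zero_apply, Nat.cast_ofNat]
  refine ⟨fun h => ?_, fun h i => ?_⟩
  · have hf (i) : f (i + 4) + f (i + 3) + f (i + 1) + f i = 0 := by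
      have := h (i + 2)
      rw [show i + 2 + 1 = i + 3 by ring, show i + 2 - 1 = i + 1 by ring,
        show i + 2 + 2 = i + 4 by ring, add_sub_cancel_right] at this
      linarith
    have hthree (i) : f (i + 6) + 2 * f (i + 3) + f i = 0 := by
      have e0 := hf i
      have e1 := hf (i + 1)
      have e2 := hf (i + 2)
      norm_num [add_assoc] at e0 e1 e2
      linarith
    have hsix (k : ℕ) (i) : f (i + 6 * k) = f i - 2 * k * (f (i + 3) + f i) := by
      induction k generalizing i with
      | zero => simp
      | succ k ih =>
        have e0 := hthree i
        have e3 := hthree (i + 3)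
        have e := ih (i + 6)
        rw [show i + 3 + 6 = i + 6 + 3 by ring, show i + 3 + 3 = i + 6 by ring] at e3
        rw [show i + 6 * ((k + 1 : ℕ) : ZMod (2 * n)) = i + 6 + 6 * k by push_cast; ring, e]
        push_cast
        linear_combination (1 + 2 * (k : ℚ)) * e0 - 2 * (k : ℚ) * e3
    intro i
    have h6 := hsix n i
    have h0 : (6 : ZMod (2 * n)) * n = 0 := by
      have := ZMod.natCast_self (2 * n)
      push_cast at this
      linear_combination 3 * this
    have hn0 : (n : ℚ) ≠ 0 := mod_cast NeZero.ne n
    rw [h0, add_zero] at h6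
    have : (n : ℚ) * (f (i + 3) + f i) = 0 := by linarith
    linarith [(mul_eq_zero.mp this).resolve_left hn0]
  · have h1 := h (i - 1)
    have h2 := h (i - 2)
    rw [show i - 1 + 3 = i + 2 by ring] at h1
    rw [show i - 2 + 3 = i + 1 by ring] at h2
    linarith

/-- For `n ≥ 3`, the nullity of the antiprism `A_n` is `3` if `3 ∣ n` and `1` otherwise. -/
theorem antiprism_nullity (n : ℕ) [NeZero n] (hn : 3 ≤ n) :
    nullity (antiprism n) = if 3 ∣ n then 3 else 1 := by
  rw [nullity, ker_adjMat_antiprism hn]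
  split_ifs with h
  · exact finrank_antiperiodicFunctions h
  · rw [antiperiodicFunctions_three_eq_one h]
    exact finrank_antiperiodicFunctions (one_dvd n)
end
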